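/- arXiv:2108.01293 — 3 statements merged into one kernel-verified Lean document; each statement's English description precedes it below -/
import Mathlib

section
/- Fix 𝔪 > 0 and d ∈ ℕ₊. For δ > 0, let I = {ν ∈ [1,2]^d : ∃ k ∈ ℤ^d such that |−Σ_{i=1}^d k_i² ν_i² + 𝔪| ≤ δ}. Then for sufficiently small δ > 0, the Lebesgue measure of I is O(δ): there is a constant C (depending on 𝔪 and d but not on δ) with mes(I) ≤ Cδ. -/
open scoped BigOperators

noncomputable section

/-- `|k| = ∑ᵢ |kᵢ|`, the ℓ¹ size of a frequency vector `k ∈ ℤᵈ`. -/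
def kAbs {d : ℕ} (k : Fin d → ℤ) : ℝ := ∑ i, |(k i : ℝ)|

/-- `|k|² = ∑ᵢ kᵢ²`. -/
def kSq {d : ℕ} (k : Fin d → ℤ) : ℝ := ∑ i, ((k i : ℝ)) ^ 2

/-- The weight `e^{2ρ|k|} (1+|k|²)^r` appearing in the `H^{ρ,r}` norm. -/
def wt {d : ℕ} (ρ r : ℝ) (k : Fin d → ℤ) : ℝ :=
  Real.exp (2 * ρ * kAbs k) * (1 + kSq k) ^ r

/-- The summand `|û_k|² e^{2ρ|k|} (1+|k|²)^r` of the squared `H^{ρ,r}` norm of the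
function with Fourier coefficients `c`. -/
def hSummand {d : ℕ} (ρ r : ℝ) (c : (Fin d → ℤ) → ℂ) (k : Fin d → ℤ) : ℝ :=
  ‖c k‖ ^ 2 * wt ρ r k

/-- Membership in `H^{ρ,r}`, expressed via the Fourier coefficients `c`. -/
def MemH {d : ℕ} (ρ r : ℝ) (c : (Fin d → ℤ) → ℂ) : Prop :=
  Summable (hSummand ρ r c)

/-- The `H^{ρ,r}` norm `(∑_k |û_k|² e^{2ρ|k|} (1+|k|²)^r)^{1/2}`. -/
def hNorm {d : ℕ} (ρ r : ℝ) (c : (Fin d → ℤ) → ℂ) : ℝ :=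
  Real.sqrt (∑' k, hSummand ρ r c k)

/-- Convolution of Fourier coefficients: the Fourier coefficients of the pointwise
product of the functions with Fourier coefficients `c₁` and `c₂`. -/
def conv {d : ℕ} (c₁ c₂ : (Fin d → ℤ) → ℂ) (k : Fin d → ℤ) : ℂ :=
  ∑' k', c₁ k' * c₂ (k - k')

/-- The eigenvalue `Υ_k = -∑ᵢ νᵢ² kᵢ² + 𝔪` of `L_{ν,𝔪} = ∑ᵢ νᵢ² ∂²/∂xᵢ² + 𝔪`
on `e^{i k·x}`. -/
def Upsilon {d : ℕ} (ν : Fin d → ℝ) (m : ℝ) (k : Fin d → ℤ) : ℝ :=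
  m - ∑ i, (ν i) ^ 2 * (k i : ℝ) ^ 2

open MeasureTheory in
lemma slab_le (n : ℕ) (m : ℝ) (δ : ℝ) (hδ : 0 < δ) (k : Fin (n+1) → ℤ) (j : Fin (n+1))
    (hj : k j ≠ 0) :
    volume {ν : Fin (n+1) → ℝ | (∀ i, ν i ∈ Set.Icc (1 : ℝ) 2) ∧
      |(-∑ i, (k i : ℝ) ^ 2 * (ν i) ^ 2) + m| ≤ δ} ≤ ENNReal.ofReal δ := by
  set S := {ν : Fin (n+1) → ℝ | (∀ i, ν i ∈ Set.Icc (1 : ℝ) 2) ∧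
      |(-∑ i, (k i : ℝ) ^ 2 * (ν i) ^ 2) + m| ≤ δ} with hS
  have hmeas : MeasurableSet S := by
    apply MeasurableSet.inter
    · have : {ν : Fin (n+1) → ℝ | ∀ i, ν i ∈ Set.Icc (1 : ℝ) 2}
          = Set.pi Set.univ (fun _ => Set.Icc (1:ℝ) 2) := by
        ext; simp only [Set.mem_pi, Set.mem_univ, true_imp_iff, Set.mem_setOf_eq]
      change MeasurableSet {ν : Fin (n+1) → ℝ | ∀ i, ν i ∈ Set.Icc (1 : ℝ) 2}
      rw [this]
      exact MeasurableSet.univ_pi fun _ => measurableSet_Icc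
    · apply IsClosed.measurableSet
      have hc : Continuous fun ν : Fin (n+1) → ℝ =>
          |(-∑ i, (k i : ℝ) ^ 2 * (ν i) ^ 2) + m| := by fun_prop
      exact isClosed_le hc continuous_const
  let e := MeasurableEquiv.piFinSuccAbove (fun _ : Fin (n+1) => ℝ) j
  have hp := (volume_preserving_piFinSuccAbove (fun _ : Fin (n+1) => ℝ) j).symm
  rw [← hp.measure_preimage hmeas.nullMeasurableSet]
  change (volume.prod volume) _ ≤ _
  rw [Measure.prod_apply_symm (hp.measurable hmeas)]
  calc _ ≤ ∫⁻ y : Fin n → ℝ, (Set.pi Set.univ (fun _ => Set.Icc (1:ℝ) 2)).indicator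
        (fun _ => ENNReal.ofReal δ) y := by
        apply lintegral_mono
        intro y
        by_cases hy : y ∈ Set.pi Set.univ (fun _ => Set.Icc (1:ℝ) 2)
        · rw [Set.indicator_of_mem hy]
          refine (Real.volume_le_diam _).trans ?_
          refine Metric.ediam_le ?_
          intro a ha b hb
          rw [edist_dist]
          apply ENNReal.ofReal_le_ofReal
          have ha' : j.insertNth (α := fun _ => ℝ) a y ∈ S := ha
          have hb' : j.insertNth (α := fun _ => ℝ) b y ∈ S := hb
          obtain ⟨ha1, ha2⟩ := ha'
          obtain ⟨hb1, hb2⟩ := hb'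
          have ha3 := (ha1 j).1
          have hb3 := (hb1 j).1
          rw [Fin.sum_univ_succAbove _ j] at ha2 hb2
          simp only [Fin.insertNth_apply_same, Fin.insertNth_apply_succAbove] at ha2 hb2 ha3 hb3
          have hk : (1:ℝ) ≤ (k j : ℝ)^2 := by
            have : (1:ℤ) ≤ (k j)^2 := by
              have := sq_pos_of_ne_zero hj
              omega
            exact_mod_cast this
          rw [abs_le] at ha2 hb2
          rw [Real.dist_eq, abs_le]
          have h1 : (k j : ℝ)^2 * (a^2 - b^2) ≤ 2 * δ := by linarith
          have h2 : (k j : ℝ)^2 * (b^2 - a^2) ≤ 2 * δ := by linarith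
          constructor
          · by_contra! h
            nlinarith [mul_le_mul_of_nonneg_right hk (show 0 ≤ b^2 - a^2 by nlinarith)]
          · by_contra! h
            nlinarith [mul_le_mul_of_nonneg_right hk (show 0 ≤ a^2 - b^2 by nlinarith)]
        · rw [Set.indicator_of_notMem hy]
          simp only [nonpos_iff_eq_zero]
          convert measure_empty (μ := (volume : Measure ℝ))
          rw [Set.eq_empty_iff_forall_notMem]
          intro a ha
          have ha' : j.insertNth (α := fun _ => ℝ) a y ∈ S := ha
          apply hy
          intro i _
          simpa using ha'.1 (j.succAbove i)
    _ = ENNReal.ofReal δ := by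
        rw [lintegral_indicator_const (MeasurableSet.univ_pi fun _ => measurableSet_Icc),
          volume_pi_pi]
        norm_num

/-- (Measure of the resonant set.) Fix `𝔪 > 0` and `d ∈ ℕ₊`. For
`δ > 0` let `I = {ν ∈ [1,2]^d : ∃ k ∈ ℤ^d, |−∑ᵢ kᵢ²νᵢ² + 𝔪| ≤ δ}`. Then there are
`C > 0` and `δ₀ > 0` (independent of `δ`) such that `mes(I) ≤ C·δ` for all `0 < δ < δ₀`. -/
theorem stmt9 (d : ℕ) (hd : 0 < d) (m : ℝ) (hm : 0 < m) :
    ∃ C : ℝ, 0 < C ∧ ∃ δ₀ : ℝ, 0 < δ₀ ∧ ∀ δ : ℝ, 0 < δ → δ < δ₀ →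
      MeasureTheory.volume
        {ν : Fin d → ℝ | (∀ i, ν i ∈ Set.Icc (1 : ℝ) 2) ∧
          ∃ k : Fin d → ℤ, |(-∑ i, (k i : ℝ) ^ 2 * (ν i) ^ 2) + m| ≤ δ} ≤
        ENNReal.ofReal (C * δ) := by
  obtain ⟨n, rfl⟩ : ∃ n, d = n + 1 := ⟨d - 1, by omega⟩
  obtain ⟨B, hB⟩ := exists_nat_gt (2 * m)
  let K : Finset (Fin (n+1) → ℤ) := Fintype.piFinset fun _ => Finset.Icc (-(B:ℤ)) B
  refine ⟨K.card + 1, by positivity, m, hm, fun δ hδ hδm => ?_⟩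
  let K' := K.filter (· ≠ 0)
  calc _ ≤ MeasureTheory.volume (⋃ k ∈ K', {ν : Fin (n+1) → ℝ | (∀ i, ν i ∈ Set.Icc (1 : ℝ) 2) ∧
          |(-∑ i, (k i : ℝ) ^ 2 * (ν i) ^ 2) + m| ≤ δ}) := by
        apply MeasureTheory.measure_mono
        rintro ν ⟨h1, k, h2⟩
        simp only [Set.mem_iUnion]
        refine ⟨k, ?_, h1, h2⟩
        rw [abs_le] at h2
        simp only [K', K, Finset.mem_filter, Fintype.mem_piFinset, Finset.mem_Icc]
        refine ⟨fun i => ?_, ?_⟩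
        · have h3 : (k i : ℝ)^2 * (ν i)^2 ≤ ∑ i, (k i : ℝ) ^ 2 * (ν i) ^ 2 :=
            Finset.single_le_sum (f := fun i => (k i : ℝ) ^ 2 * (ν i) ^ 2)
              (fun i _ => by positivity) (Finset.mem_univ i)
          have h4 := (h1 i).1
          have h5 : (k i : ℝ)^2 ≤ (k i : ℝ)^2 * (ν i)^2 :=
            le_mul_of_one_le_right (by positivity) (by nlinarith)
          have h6 : (k i : ℝ)^2 < B := by linarith
          have h7 : (k i)^2 < (B:ℤ) := by exact_mod_cast h6
          constructor <;> nlinarith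
        · rintro rfl
          simp at h2
          linarith
    _ ≤ ∑ k ∈ K', ENNReal.ofReal δ := by
        refine (MeasureTheory.measure_biUnion_finset_le _ _).trans ?_
        apply Finset.sum_le_sum
        intro k hk
        obtain ⟨j, hj⟩ := Function.ne_iff.mp (Finset.mem_filter.mp hk).2
        exact slab_le n m δ hδ k j hj
    _ ≤ ENNReal.ofReal ((K.card + 1) * δ) := by
        rw [Finset.sum_const, ← ENNReal.ofReal_nsmul]
        apply ENNReal.ofReal_le_ofReal
        rw [nsmul_eq_mul]
        have : (K'.card : ℝ) ≤ K.card := by exact_mod_cast Finset.card_filter_le _ _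
        nlinarith
end
end

section
/- Fix d ∈ ℕ₊, ρ ≥ 0, r > d/2, ν ∈ [1,2]^d and 𝔪₀ > 0 such that the kernel of L_{ν,𝔪₀} in H^{ρ,r} is spanned by finitely many exponentials e^{ik^j·x}, j = 1,…,2^d. Let Π_R be the orthogonal projection onto the closure of the range of L_{ν,𝔪₀}, let (L^R_{ν,𝔪₀})^{-1} denote the inverse of L_{ν,𝔪₀} on the range, and set v̄(α) = Σ_{j=1}^{2^d} α_j e^{ik^j·x}. Let H^{θ,ρ,r} (0 < θ ≪ 1) be the Banach algebra of formal power series v(α) = Σ_{j∈ℕ^{2^d}} v_j α^j with v_j ∈ H^{ρ,r} and ‖v‖_{θ,ρ,r} = Σ_j ‖v_j‖_{ρ,r} θ^{|j|} < ∞. If 𝔪 − 𝔪₀ = O(ε) with ε sufficiently small, then the range equation v̂ = (L^R_{ν,𝔪₀})^{-1}(−(𝔪−𝔪₀) v̂ + Π_R (v̂ + v̄)²) has a unique solution v̂ in a suitable closed ball of H^{θ,ρ,r}; in particular v̂ is analytic in α ∈ ℂ^{2^d}. -/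
open scoped BigOperators

noncomputable section

/-- Formal power series in `2^d` complex variables `α` with coefficients in the space of
Fourier coefficient sequences (i.e. in `H^{ρ,r}`): the model for `H^{θ,ρ,r}`. -/
def PS (d : ℕ) : Type := (Fin (2 ^ d) → ℕ) → (Fin d → ℤ) → ℂ

/-- The summand `‖v_j‖_{ρ,r} θ^{|j|}` of the `H^{θ,ρ,r}` norm. -/
def psSummand {d : ℕ} (θ ρ r : ℝ) (v : PS d) (j : Fin (2 ^ d) → ℕ) : ℝ :=
  hNorm ρ r (v j) * θ ^ (∑ i, j i)

/-- Membership in the Banach algebra `H^{θ,ρ,r}`. -/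
def MemPS {d : ℕ} (θ ρ r : ℝ) (v : PS d) : Prop :=
  (∀ j, MemH ρ r (v j)) ∧ Summable (psSummand θ ρ r v)

/-- The norm `‖v‖_{θ,ρ,r} = ∑_j ‖v_j‖_{ρ,r} θ^{|j|}` of `H^{θ,ρ,r}`. -/
def psNorm {d : ℕ} (θ ρ r : ℝ) (v : PS d) : ℝ :=
  ∑' j, psSummand θ ρ r v j

/-- Product of two formal power series: Cauchy product in `α` together with convolution
(= pointwise product of the corresponding functions on the torus) in `x`. -/
def psMul {d : ℕ} (u v : PS d) : PS d :=
  fun j => ∑ p ∈ Finset.Iic j, conv (u p) (v (j - p))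

open Classical in
/-- The element `v̄(α) = ∑_m α_m e^{i k^m · x}` of the kernel, as a formal power series:
its coefficient at the multi-index `e_m` is the delta function at `k^m`. -/
def vbar {d : ℕ} (km : Fin (2 ^ d) → Fin d → ℤ) : PS d :=
  fun j k => if ∃ m, j = Pi.single m 1 ∧ k = km m then 1 else 0

namespace Aux

lemma kSq_nonneg {d : ℕ} (k : Fin d → ℤ) : 0 ≤ kSq k :=
  Finset.sum_nonneg fun _ _ => sq_nonneg _

lemma base_pos {d : ℕ} (k : Fin d → ℤ) : 0 < 1 + kSq k := by
  have := kSq_nonneg k; linarith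

lemma wt_pos {d : ℕ} (ρ r : ℝ) (k : Fin d → ℤ) : 0 < wt ρ r k :=
  mul_pos (Real.exp_pos _) (Real.rpow_pos_of_pos (base_pos k) _)

/-- the summable weight -/
def gw {d : ℕ} (r : ℝ) (k : Fin d → ℤ) : ℝ := (1 + kSq k) ^ (-r)

lemma gw_nonneg {d : ℕ} (r : ℝ) (k : Fin d → ℤ) : 0 ≤ gw r k :=
  Real.rpow_nonneg (base_pos k).le _

lemma summable_gw {d : ℕ} (r : ℝ) (hr : (d : ℝ) / 2 < r) : Summable (gw (d := d) r) := by
  let b := Pi.basisFun ℝ (Fin d)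
  let Λ : Submodule ℤ (Fin d → ℝ) := Submodule.span ℤ (Set.range b)
  have hrank : Module.finrank ℤ Λ = d := by
    rw [ZLattice.rank ℝ Λ]; simp
  have hs : Summable fun z : Λ => ‖z‖ ^ (-(2 * r)) :=
    ZLattice.summable_norm_rpow Λ _ (by rw [hrank]; linarith)
  let f : (Fin d → ℤ) → Λ := fun k => ⟨fun i => (k i : ℝ), by
    have : (fun i => (k i : ℝ)) = ∑ i, k i • b i := by
      ext j
      simp [b, Finset.sum_apply, Pi.single_apply]
    rw [this]
    exact Submodule.sum_mem _ fun i _ => Submodule.smul_mem _ _ (Submodule.subset_span ⟨i, rfl⟩)⟩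
  have hf : Function.Injective f := by
    intro k k' h
    have h1 := congrArg Subtype.val h
    ext i
    have h2 := congrFun h1 i
    simpa [f] using h2
  have hs2 := hs.comp_injective hf
  have hr0 : 0 < r := lt_of_le_of_lt (by positivity) hr
  refine Summable.of_norm_bounded_eventually hs2 ?_
  have : ∀ᶠ k : Fin d → ℤ in Filter.cofinite, k ≠ 0 := by
    simp [Filter.eventually_cofinite]
  filter_upwards [this] with k hk
  rw [Real.norm_of_nonneg (gw_nonneg r k)]
  have hpos : 0 < ‖f k‖ := by
    rw [norm_pos_iff]
    intro h
    apply hk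
    apply hf
    rw [h]; ext i; simp [f]
  have hle : ‖f k‖ ^ 2 ≤ 1 + kSq k := by
    have h1 : ‖f k‖ ≤ Real.sqrt (1 + kSq k) := by
      change ‖(fun i => (k i : ℝ))‖ ≤ _
      rw [pi_norm_le_iff_of_nonneg (Real.sqrt_nonneg _)]
      intro i
      apply Real.le_sqrt_of_sq_le
      have := Finset.single_le_sum (f := fun i => ((k i : ℝ)) ^ 2) (fun _ _ => sq_nonneg _)
        (Finset.mem_univ i)
      rw [Real.norm_eq_abs, sq_abs]
      unfold kSq
      linarith
    calc ‖f k‖ ^ 2 ≤ (Real.sqrt (1 + kSq k)) ^ 2 := by gcongr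
      _ = _ := Real.sq_sqrt (base_pos k).le
  change (1 + kSq k) ^ (-r) ≤ ‖f k‖ ^ (-(2 * r))
  have e : ‖f k‖ ^ (-(2 * r)) = (‖f k‖ ^ 2) ^ (-r) := by
    rw [← Real.rpow_natCast, ← Real.rpow_mul hpos.le]; congr 1; push_cast; ring
  rw [e]
  exact Real.rpow_le_rpow_of_nonpos (by positivity) hle (by linarith)

lemma kAbs_le {d : ℕ} (k k' : Fin d → ℤ) : kAbs k ≤ kAbs k' + kAbs (k - k') := by
  unfold kAbs
  rw [← Finset.sum_add_distrib]
  refine Finset.sum_le_sum fun i _ => ?_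
  have := abs_add_le (k' i : ℝ) ((k i : ℝ) - k' i)
  simpa using this

lemma kSq_le {d : ℕ} (k k' : Fin d → ℤ) : kSq k ≤ 2 * (kSq k' + kSq (k - k')) := by
  unfold kSq
  rw [← Finset.sum_add_distrib, Finset.mul_sum]
  refine Finset.sum_le_sum fun i _ => ?_
  simp only [Pi.sub_apply, Int.cast_sub]
  nlinarith [sq_nonneg ((k' i : ℝ) - (k i - k' i))]

lemma wt_le {d : ℕ} {ρ r : ℝ} (hρ : 0 ≤ ρ) (hr : 0 < r) (k k' : Fin d → ℤ) :
    wt ρ r k ≤ 4 ^ r * (gw r k' + gw r (k - k')) * (wt ρ r k' * wt ρ r (k - k')) := by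
  unfold wt gw
  set A := 1 + kSq k'
  set B := 1 + kSq (k - k')
  have hA : 0 < A := base_pos _
  have hB : 0 < B := base_pos _
  have h1 : 1 + kSq k ≤ 4 * max A B := by
    have := kSq_le k k'
    have := le_max_left A B
    have := le_max_right A B
    simp only [A, B] at *
    linarith
  have h2 : (1 + kSq k) ^ r ≤ 4 ^ r * (A ^ r + B ^ r) := by
    calc (1 + kSq k) ^ r ≤ (4 * max A B) ^ r :=
          Real.rpow_le_rpow (base_pos k).le h1 hr.le
      _ = 4 ^ r * (max A B) ^ r := Real.mul_rpow (by norm_num) (hA.le.trans (le_max_left _ _))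
      _ ≤ _ := by
        gcongr
        have hA' := Real.rpow_nonneg hA.le r
        have hB' := Real.rpow_nonneg hB.le r
        rcases le_total A B with h | h
        · rw [max_eq_right h]; linarith
        · rw [max_eq_left h]; linarith
  have h3 : Real.exp (2 * ρ * kAbs k) ≤
      Real.exp (2 * ρ * kAbs k') * Real.exp (2 * ρ * kAbs (k - k')) := by
    rw [← Real.exp_add, ← mul_add]
    gcongr
    exact kAbs_le k k'
  have hA' := Real.rpow_pos_of_pos hA r
  have hB' := Real.rpow_pos_of_pos hB r
  calc _ ≤ (Real.exp (2 * ρ * kAbs k') * Real.exp (2 * ρ * kAbs (k - k'))) *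
      (4 ^ r * (A ^ r + B ^ r)) := by
        gcongr
        exact Real.rpow_nonneg (base_pos k).le _
    _ = _ := by
      rw [Real.rpow_neg hA.le, Real.rpow_neg hB.le]
      field_simp
      ring

/-- the constant -/
def Mc (d : ℕ) (r : ℝ) : ℝ := 4 ^ r * (2 * ∑' k : Fin d → ℤ, gw r k)

lemma Mc_nonneg (d : ℕ) (r : ℝ) : 0 ≤ Mc d r := by
  unfold Mc
  have : 0 ≤ ∑' k : Fin d → ℤ, gw r k := tsum_nonneg (gw_nonneg r)
  positivity

lemma hSummand_nonneg {d : ℕ} (ρ r : ℝ) (c : (Fin d → ℤ) → ℂ) (k : Fin d → ℤ) :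
    0 ≤ hSummand ρ r c k := mul_nonneg (sq_nonneg _) (wt_pos ρ r k).le

lemma hasSum_pair {d : ℕ} {ρ r : ℝ} {c₁ c₂ : (Fin d → ℤ) → ℂ}
    (h₁ : MemH ρ r c₁) (h₂ : MemH ρ r c₂) :
    HasSum (fun p : (Fin d → ℤ) × (Fin d → ℤ) => hSummand ρ r c₁ p.2 * hSummand ρ r c₂ (p.1 - p.2))
      ((∑' k, hSummand ρ r c₁ k) * (∑' k, hSummand ρ r c₂ k)) := by
  have hs : Summable fun p : (Fin d → ℤ) × (Fin d → ℤ) =>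
      hSummand ρ r c₁ p.1 * hSummand ρ r c₂ p.2 :=
    h₁.mul_of_nonneg h₂ (hSummand_nonneg _ _ _) (hSummand_nonneg _ _ _)
  have hh := (HasSum.mul h₁.hasSum h₂.hasSum hs)
  let e : (Fin d → ℤ) × (Fin d → ℤ) ≃ (Fin d → ℤ) × (Fin d → ℤ) :=
    { toFun := fun p => (p.2, p.1 - p.2)
      invFun := fun q => (q.1 + q.2, q.1)
      left_inv := fun p => by simp
      right_inv := fun p => by simp }
  exact (e.hasSum_iff).2 hh

lemma summable_row {d : ℕ} {ρ r : ℝ} {c₁ c₂ : (Fin d → ℤ) → ℂ}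
    (h₁ : MemH ρ r c₁) (h₂ : MemH ρ r c₂) (k : Fin d → ℤ) :
    Summable fun k' => hSummand ρ r c₁ k' * hSummand ρ r c₂ (k - k') :=
  (hasSum_pair h₁ h₂).summable.prod_factor k

lemma conv_sum_le {d : ℕ} {ρ r : ℝ} (hρ : 0 ≤ ρ) (hr : (d : ℝ) / 2 < r)
    {c₁ c₂ : (Fin d → ℤ) → ℂ}
    (h₁ : MemH ρ r c₁) (h₂ : MemH ρ r c₂) (k : Fin d → ℤ) (s : Finset (Fin d → ℤ)) :
    (∑ k' ∈ s, ‖c₁ k' * c₂ (k - k')‖) ≤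
      Real.sqrt ((∑' k', hSummand ρ r c₁ k' * hSummand ρ r c₂ (k - k')) *
        (Mc d r / wt ρ r k)) := by
  have hr0 : 0 < r := lt_of_le_of_lt (by positivity) hr
  apply Real.le_sqrt_of_sq_le
  refine (Finset.sum_sq_le_sum_mul_sum_of_sq_le_mul s
    (f := fun k' => hSummand ρ r c₁ k' * hSummand ρ r c₂ (k - k'))
    (g := fun k' => 1 / (wt ρ r k' * wt ρ r (k - k'))) ?_ ?_ ?_).trans ?_
  · intro i _; exact mul_nonneg (hSummand_nonneg _ _ _ _) (hSummand_nonneg _ _ _ _)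
  · intro i _
    have := wt_pos ρ r i
    have := wt_pos ρ r (k - i)
    positivity
  · intro i _
    have := wt_pos ρ r i
    have := wt_pos ρ r (k - i)
    rw [norm_mul]
    unfold hSummand
    apply le_of_eq
    field_simp
  · have hg := summable_gw r hr
    have hwk := wt_pos ρ r k
    have hg2 : Summable fun k' => gw r (k - k') := by
      exact ((Equiv.subLeft k).summable_iff (f := gw r)).2 hg
    have hg2t : ∑' k', gw r (k - k') = ∑' k', gw r k' :=
      (Equiv.subLeft k).tsum_eq (gw r)
    refine mul_le_mul ?_ ?_ ?_ ?_
    · exact (summable_row h₁ h₂ k).sum_le_tsum _ fun i _ =>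
        mul_nonneg (hSummand_nonneg _ _ _ _) (hSummand_nonneg _ _ _ _)
    · rw [le_div_iff₀ hwk, Finset.sum_mul]
      calc _ ≤ ∑ i ∈ s, 4 ^ r * (gw r i + gw r (k - i)) := by
            refine Finset.sum_le_sum fun i _ => ?_
            have h1 := wt_pos ρ r i
            have h2 := wt_pos ρ r (k - i)
            rw [one_div_mul_eq_div, div_le_iff₀ (by positivity)]
            exact wt_le hρ hr0 k i
        _ ≤ ∑' i, 4 ^ r * (gw r i + gw r (k - i)) :=
            ((hg.add hg2).mul_left _).sum_le_tsum _ fun i _ =>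
              mul_nonneg (by positivity) (add_nonneg (gw_nonneg _ _) (gw_nonneg _ _))
        _ = _ := by
            rw [tsum_mul_left, hg.tsum_add hg2, hg2t, Mc]; ring
    · refine Finset.sum_nonneg fun i _ => ?_
      have := wt_pos ρ r i
      have := wt_pos ρ r (k - i)
      positivity
    · exact tsum_nonneg fun i =>
        mul_nonneg (hSummand_nonneg _ _ _ _) (hSummand_nonneg _ _ _ _)

lemma conv_summable {d : ℕ} {ρ r : ℝ} (hρ : 0 ≤ ρ) (hr : (d : ℝ) / 2 < r)
    {c₁ c₂ : (Fin d → ℤ) → ℂ}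
    (h₁ : MemH ρ r c₁) (h₂ : MemH ρ r c₂) (k : Fin d → ℤ) :
    Summable fun k' => c₁ k' * c₂ (k - k') :=
  Summable.of_norm (summable_of_sum_le (fun _ => norm_nonneg _) (conv_sum_le hρ hr h₁ h₂ k))

lemma hSummand_conv_le {d : ℕ} {ρ r : ℝ} (hρ : 0 ≤ ρ) (hr : (d : ℝ) / 2 < r)
    {c₁ c₂ : (Fin d → ℤ) → ℂ}
    (h₁ : MemH ρ r c₁) (h₂ : MemH ρ r c₂) (k : Fin d → ℤ) :
    hSummand ρ r (conv c₁ c₂) k ≤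
      Mc d r * ∑' k', hSummand ρ r c₁ k' * hSummand ρ r c₂ (k - k') := by
  have hwk := wt_pos ρ r k
  have hs : Summable fun k' => ‖c₁ k' * c₂ (k - k')‖ :=
    summable_of_sum_le (fun _ => norm_nonneg _) (conv_sum_le hρ hr h₁ h₂ k)
  have h0 : 0 ≤ ∑' k', hSummand ρ r c₁ k' * hSummand ρ r c₂ (k - k') :=
    tsum_nonneg fun i => mul_nonneg (hSummand_nonneg _ _ _ _) (hSummand_nonneg _ _ _ _)
  have h := (norm_tsum_le_tsum_norm hs).trans (hs.tsum_le_of_sum_le (conv_sum_le hρ hr h₁ h₂ k))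
  have hM := Mc_nonneg d r
  have h2 : ‖conv c₁ c₂ k‖ ^ 2 ≤ (∑' k', hSummand ρ r c₁ k' * hSummand ρ r c₂ (k - k')) *
        (Mc d r / wt ρ r k) := by
    rw [← Real.sq_sqrt (mul_nonneg h0 (div_nonneg hM hwk.le))]
    exact pow_le_pow_left₀ (norm_nonneg _) h 2
  calc _ ≤ (∑' k', hSummand ρ r c₁ k' * hSummand ρ r c₂ (k - k')) *
        (Mc d r / wt ρ r k) * wt ρ r k := mul_le_mul_of_nonneg_right h2 hwk.le
    _ = _ := by field_simp

lemma memH_conv {d : ℕ} {ρ r : ℝ} (hρ : 0 ≤ ρ) (hr : (d : ℝ) / 2 < r)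
    {c₁ c₂ : (Fin d → ℤ) → ℂ} (h₁ : MemH ρ r c₁) (h₂ : MemH ρ r c₂) :
    MemH ρ r (conv c₁ c₂) :=
  Summable.of_nonneg_of_le (hSummand_nonneg _ _ _) (hSummand_conv_le hρ hr h₁ h₂)
    ((hasSum_pair h₁ h₂).summable.prod.mul_left _)

lemma hNorm_nonneg {d : ℕ} (ρ r : ℝ) (c : (Fin d → ℤ) → ℂ) : 0 ≤ hNorm ρ r c :=
  Real.sqrt_nonneg _

lemma hNorm_conv_le {d : ℕ} {ρ r : ℝ} (hρ : 0 ≤ ρ) (hr : (d : ℝ) / 2 < r)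
    {c₁ c₂ : (Fin d → ℤ) → ℂ} (h₁ : MemH ρ r c₁) (h₂ : MemH ρ r c₂) :
    hNorm ρ r (conv c₁ c₂) ≤ Real.sqrt (Mc d r) * (hNorm ρ r c₁ * hNorm ρ r c₂) := by
  unfold hNorm
  have hp := hasSum_pair h₁ h₂
  rw [← Real.sqrt_mul (tsum_nonneg (hSummand_nonneg _ _ _)), ← Real.sqrt_mul (Mc_nonneg d r)]
  apply Real.sqrt_le_sqrt
  calc _ ≤ ∑' k, Mc d r * ∑' k', hSummand ρ r c₁ k' * hSummand ρ r c₂ (k - k') :=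
        (memH_conv hρ hr h₁ h₂).tsum_le_tsum (hSummand_conv_le hρ hr h₁ h₂)
          (hp.summable.prod.mul_left _)
    _ = _ := by
      rw [tsum_mul_left, ← hp.tsum_eq, hp.summable.tsum_prod]

/-! ### the sequence-space model -/

/-- weighted ℓ² -/
abbrev HL (d : ℕ) := lp (fun _ : Fin d → ℤ => ℂ) 2

/-- weighted ℓ¹(ℓ²) -/
abbrev EL (d : ℕ) := lp (fun _ : Fin (2 ^ d) → ℕ => HL d) 1

lemma term_eq {d : ℕ} (ρ r : ℝ) (c : (Fin d → ℤ) → ℂ) (k : Fin d → ℤ) :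
    ‖((Real.sqrt (wt ρ r k) : ℝ) : ℂ) * c k‖ ^ (2 : ENNReal).toReal = hSummand ρ r c k := by
  have := wt_pos ρ r k
  simp only [ENNReal.toReal_ofNat, Real.rpow_ofNat, norm_mul, Complex.norm_real, mul_pow, hSummand]
  rw [Real.norm_of_nonneg (Real.sqrt_nonneg _), Real.sq_sqrt this.le]; ring

lemma memH_iff {d : ℕ} {ρ r : ℝ} {c : (Fin d → ℤ) → ℂ} :
    MemH ρ r c ↔ Memℓp (E := fun _ : Fin d → ℤ => ℂ)
      (fun k => ((Real.sqrt (wt ρ r k) : ℝ) : ℂ) * c k) 2 := by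
  rw [memℓp_gen_iff (by norm_num)]
  simp only [term_eq]
  rfl

/-- embedding of `H^{ρ,r}` into `ℓ²` -/
def toL {d : ℕ} {ρ r : ℝ} (c : (Fin d → ℤ) → ℂ) (h : MemH ρ r c) : HL d :=
  ⟨fun k => ((Real.sqrt (wt ρ r k) : ℝ) : ℂ) * c k, memH_iff.1 h⟩

lemma toL_apply {d : ℕ} {ρ r : ℝ} (c : (Fin d → ℤ) → ℂ) (h : MemH ρ r c) (k : Fin d → ℤ) :
    toL c h k = ((Real.sqrt (wt ρ r k) : ℝ) : ℂ) * c k := rfl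

lemma norm_toL {d : ℕ} {ρ r : ℝ} (c : (Fin d → ℤ) → ℂ) (h : MemH ρ r c) :
    ‖toL c h‖ = hNorm ρ r c := by
  rw [lp.norm_eq_tsum_rpow (by norm_num)]
  simp only [toL_apply, term_eq]
  rw [hNorm, Real.sqrt_eq_rpow]
  norm_num

lemma memH_add {d : ℕ} {ρ r : ℝ} {c₁ c₂ : (Fin d → ℤ) → ℂ}
    (h₁ : MemH ρ r c₁) (h₂ : MemH ρ r c₂) : MemH ρ r (c₁ + c₂) := by
  rw [memH_iff] at *
  convert h₁.add h₂ using 1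
  ext k
  simp [mul_add]

lemma hNorm_add_le {d : ℕ} {ρ r : ℝ} {c₁ c₂ : (Fin d → ℤ) → ℂ}
    (h₁ : MemH ρ r c₁) (h₂ : MemH ρ r c₂) :
    hNorm ρ r (c₁ + c₂) ≤ hNorm ρ r c₁ + hNorm ρ r c₂ := by
  rw [← norm_toL _ h₁, ← norm_toL _ h₂, ← norm_toL _ (memH_add h₁ h₂)]
  refine le_trans (le_of_eq ?_) (norm_add_le _ _)
  congr 1
  ext k
  simp [toL_apply, mul_add]

lemma memH_zero {d : ℕ} {ρ r : ℝ} : MemH (d := d) ρ r 0 := by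
  unfold MemH
  have : hSummand (d := d) ρ r 0 = 0 := by ext k; simp [hSummand]
  rw [this]; exact summable_zero

lemma hNorm_zero {d : ℕ} {ρ r : ℝ} : hNorm (d := d) ρ r 0 = 0 := by
  have : hSummand (d := d) ρ r 0 = 0 := by ext k; simp [hSummand]
  simp [hNorm, this]

lemma memH_sum {d : ℕ} {ρ r : ℝ} {ι : Type*} (s : Finset ι) (f : ι → (Fin d → ℤ) → ℂ)
    (h : ∀ i ∈ s, MemH ρ r (f i)) :
    MemH ρ r (∑ i ∈ s, f i) ∧ hNorm ρ r (∑ i ∈ s, f i) ≤ ∑ i ∈ s, hNorm ρ r (f i) := by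
  classical
  induction s using Finset.induction_on with
  | empty => simp [memH_zero, hNorm_zero]
  | insert a s ha ih =>
    have h1 := ih fun i hi => h i (Finset.mem_insert_of_mem hi)
    have h2 := h a (Finset.mem_insert_self _ _)
    rw [Finset.sum_insert ha, Finset.sum_insert ha]
    exact ⟨memH_add h2 h1.1, (hNorm_add_le h2 h1.1).trans (by linarith [h1.2])⟩

lemma memH_diag {d : ℕ} {ρ r : ℝ} {c : (Fin d → ℤ) → ℂ} (h : MemH ρ r c)
    {C : ℝ} (hC : 0 ≤ C) (l : (Fin d → ℤ) → ℂ) (hl : ∀ k, ‖l k‖ ≤ C) :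
    MemH ρ r (fun k => l k * c k) ∧ hNorm ρ r (fun k => l k * c k) ≤ C * hNorm ρ r c := by
  have hle : ∀ k, hSummand ρ r (fun k => l k * c k) k ≤ C ^ 2 * hSummand ρ r c k := by
    intro k
    unfold hSummand
    rw [norm_mul, mul_pow, mul_assoc]
    have := wt_pos ρ r k
    gcongr
    exact hl k
  have hm : MemH ρ r (fun k => l k * c k) :=
    Summable.of_nonneg_of_le (hSummand_nonneg _ _ _) hle (h.mul_left _)
  refine ⟨hm, ?_⟩
  unfold hNorm
  rw [← Real.sqrt_sq hC, ← Real.sqrt_mul (sq_nonneg _)]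
  apply Real.sqrt_le_sqrt
  rw [← tsum_mul_left]
  exact hm.tsum_le_tsum hle (h.mul_left _)

lemma hasSum_iic {n : ℕ} {a b : (Fin n → ℕ) → ℝ} (ha : ∀ i, 0 ≤ a i) (hb : ∀ i, 0 ≤ b i)
    (sa : Summable a) (sb : Summable b) :
    HasSum (fun j => ∑ p ∈ Finset.Iic j, a p * b (j - p)) ((∑' i, a i) * ∑' i, b i) := by
  have hs := HasSum.mul sa.hasSum sb.hasSum (sa.mul_of_nonneg sb ha hb)
  let e : (Σ j : Fin n → ℕ, {p // p ∈ Finset.Iic j}) ≃ (Fin n → ℕ) × (Fin n → ℕ) :=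
    { toFun := fun x => (x.2.1, x.1 - x.2.1)
      invFun := fun q => ⟨q.1 + q.2, ⟨q.1, by simp⟩⟩
      left_inv := by
        rintro ⟨j, p, hp⟩
        have hp' : p ≤ j := Finset.mem_Iic.1 hp
        have : p + (j - p) = j := add_tsub_cancel_of_le hp'
        simp only
        congr 1
        rw [Subtype.heq_iff_coe_eq]
        intro x; rw [this]
      right_inv := by rintro ⟨p, q⟩; simp }
  have h2 := (e.hasSum_iff).2 hs
  refine h2.sigma fun j => ?_
  have h3 := hasSum_fintype (fun p : {p // p ∈ Finset.Iic j} => a p.1 * b (j - p.1))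
  rw [Finset.sum_coe_sort (Finset.Iic j) (fun p => a p * b (j - p))] at h3
  exact h3

lemma psSummand_nonneg {d : ℕ} {θ : ℝ} (hθ : 0 ≤ θ) (ρ r : ℝ) (v : PS d) (j) :
    0 ≤ psSummand θ ρ r v j := mul_nonneg (hNorm_nonneg _ _ _) (pow_nonneg hθ _)

lemma memPS_mul {d : ℕ} {θ ρ r : ℝ} (hθ : 0 ≤ θ) (hρ : 0 ≤ ρ) (hr : (d : ℝ) / 2 < r)
    {u v : PS d} (hu : MemPS θ ρ r u) (hv : MemPS θ ρ r v) :
    MemPS θ ρ r (psMul u v) ∧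
      psNorm θ ρ r (psMul u v) ≤ Real.sqrt (Mc d r) * (psNorm θ ρ r u * psNorm θ ρ r v) := by
  have hs := (hasSum_iic (psSummand_nonneg hθ ρ r u) (psSummand_nonneg hθ ρ r v) hu.2 hv.2).mul_left
    (Real.sqrt (Mc d r))
  have hm : ∀ j, MemH ρ r (psMul u v j) := fun j =>
    (memH_sum _ _ fun p _ => memH_conv hρ hr (hu.1 p) (hv.1 (j - p))).1
  have hle : ∀ j, psSummand θ ρ r (psMul u v) j ≤ Real.sqrt (Mc d r) *
      ∑ p ∈ Finset.Iic j, psSummand θ ρ r u p * psSummand θ ρ r v (j - p) := by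
    intro j
    have h1 := (memH_sum (Finset.Iic j) (fun p => conv (u p) (v (j - p)))
      fun p _ => memH_conv hρ hr (hu.1 p) (hv.1 (j - p))).2
    refine (mul_le_mul_of_nonneg_right h1 (pow_nonneg hθ _)).trans ?_
    rw [Finset.sum_mul, Finset.mul_sum]
    refine Finset.sum_le_sum fun p hp => ?_
    have hp' : p ≤ j := Finset.mem_Iic.1 hp
    have e : ∑ i, j i = ∑ i, p i + ∑ i, (j - p) i := by
      rw [← Finset.sum_add_distrib]
      refine Finset.sum_congr rfl fun i _ => ?_
      have : p i ≤ j i := hp' i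
      simp only [Pi.sub_apply]; omega
    rw [e, pow_add]
    refine (mul_le_mul_of_nonneg_right (hNorm_conv_le hρ hr (hu.1 p) (hv.1 (j - p)))
      (by positivity)).trans (le_of_eq ?_)
    unfold psSummand
    ring
  have hsum : Summable (psSummand θ ρ r (psMul u v)) :=
    Summable.of_nonneg_of_le (psSummand_nonneg hθ ρ r _) hle hs.summable
  refine ⟨⟨hm, hsum⟩, ?_⟩
  unfold psNorm
  rw [← hs.tsum_eq]
  exact hsum.tsum_le_tsum hle hs.summable

lemma memPS_diag {d : ℕ} {θ ρ r : ℝ} (hθ : 0 ≤ θ) {v : PS d} (hv : MemPS θ ρ r v)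
    {C : ℝ} (hC : 0 ≤ C) (l : (Fin d → ℤ) → ℂ) (hl : ∀ k, ‖l k‖ ≤ C) :
    MemPS θ ρ r (fun j k => l k * v j k) ∧
      psNorm θ ρ r (fun j k => l k * v j k) ≤ C * psNorm θ ρ r v := by
  have hle : ∀ j, psSummand θ ρ r (fun j k => l k * v j k) j ≤ C * psSummand θ ρ r v j := by
    intro j
    unfold psSummand
    rw [← mul_assoc]
    exact mul_le_mul_of_nonneg_right (memH_diag (hv.1 j) hC l hl).2 (by positivity)
  have hsum : Summable (psSummand θ ρ r (fun j k => l k * v j k)) :=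
    Summable.of_nonneg_of_le (psSummand_nonneg hθ ρ r _) hle (hv.2.mul_left _)
  refine ⟨⟨fun j => (memH_diag (hv.1 j) hC l hl).1, hsum⟩, ?_⟩
  unfold psNorm
  rw [← tsum_mul_left]
  exact hsum.tsum_le_tsum hle (hv.2.mul_left _)

lemma psMul_add_left {d : ℕ} {θ ρ r : ℝ} (hρ : 0 ≤ ρ) (hr : (d : ℝ) / 2 < r)
    {u u' v : PS d} (hu : MemPS θ ρ r u) (hu' : MemPS θ ρ r u') (hv : MemPS θ ρ r v) :
    psMul (fun j => u j + u' j) v = fun j => psMul u v j + psMul u' v j := by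
  funext j
  unfold psMul
  rw [← Finset.sum_add_distrib]
  refine Finset.sum_congr rfl fun p _ => ?_
  funext k
  simp only [conv, Pi.add_apply, add_mul]
  exact (conv_summable hρ hr (hu.1 p) (hv.1 _) k).tsum_add (conv_summable hρ hr (hu'.1 p) (hv.1 _) k)

lemma psMul_add_right {d : ℕ} {θ ρ r : ℝ} (hρ : 0 ≤ ρ) (hr : (d : ℝ) / 2 < r)
    {u v v' : PS d} (hu : MemPS θ ρ r u) (hv : MemPS θ ρ r v) (hv' : MemPS θ ρ r v') :
    psMul u (fun j => v j + v' j) = fun j => psMul u v j + psMul u v' j := by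
  funext j
  unfold psMul
  rw [← Finset.sum_add_distrib]
  refine Finset.sum_congr rfl fun p _ => ?_
  funext k
  simp only [conv, Pi.add_apply, mul_add]
  exact (conv_summable hρ hr (hu.1 p) (hv.1 _) k).tsum_add (conv_summable hρ hr (hu.1 p) (hv'.1 _) k)

lemma vbar_spec {d : ℕ} (ρ r : ℝ) (km : Fin (2 ^ d) → Fin d → ℤ) :
    ∃ V : ℝ, 0 ≤ V ∧ ∀ θ : ℝ, MemPS θ ρ r (vbar km) ∧ psNorm θ ρ r (vbar km) = V * θ := by
  classical
  have hz : ∀ j : Fin (2 ^ d) → ℕ, (¬ ∃ m, j = Pi.single m 1) → vbar km j = 0 := by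
    intro j hj
    funext k
    simp only [vbar, Pi.zero_apply, ite_eq_right_iff, one_ne_zero, imp_false]
    rintro ⟨m, hm, _⟩
    exact hj ⟨m, hm⟩
  have hps : ∀ θ : ℝ, psSummand θ ρ r (vbar km) = fun j => hNorm ρ r (vbar km j) * θ := by
    intro θ
    funext j
    unfold psSummand
    by_cases hj : ∃ m, j = Pi.single m 1
    · obtain ⟨m, rfl⟩ := hj
      simp
    · rw [hz j hj, hNorm_zero]; simp
  have hmem : ∀ j, MemH ρ r (vbar km j) := by
    intro j
    refine summable_of_ne_finset_zero (s := Finset.univ.image km) fun k hk => ?_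
    have : vbar km j k = 0 := by
      simp only [vbar, ite_eq_right_iff, one_ne_zero, imp_false]
      rintro ⟨m, _, rfl⟩
      exact hk (by simp)
    simp [hSummand, this]
  have hsum : Summable fun j => hNorm ρ r (vbar km j) := by
    refine summable_of_ne_finset_zero
      (s := Finset.univ.image fun m => (Pi.single m 1 : Fin (2 ^ d) → ℕ)) fun j hj => ?_
    rw [hz j, hNorm_zero]
    rintro ⟨m, rfl⟩
    exact hj (by simp)
  refine ⟨∑' j, hNorm ρ r (vbar km j), tsum_nonneg fun _ => hNorm_nonneg _ _ _, fun θ =>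
    ⟨⟨hmem, ?_⟩, ?_⟩⟩
  · rw [hps]; exact hsum.mul_right _
  · rw [psNorm, hps, tsum_mul_right]

/-- the element of the model attached to a power series -/
def ofPS {d : ℕ} {θ ρ r : ℝ} (hθ : 0 < θ) (v : PS d) (h : MemPS θ ρ r v) : EL d :=
  ⟨fun j => ((θ ^ (∑ i, j i) : ℝ) : ℂ) • toL (v j) (h.1 j), by
    refine memℓp_gen ?_
    refine h.2.congr fun j => ?_
    simp only [ENNReal.toReal_one, Real.rpow_one]
    rw [norm_smul, norm_toL, Complex.norm_real, Real.norm_of_nonneg (by positivity), mul_comm]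
    rfl⟩

lemma ofPS_apply {d : ℕ} {θ ρ r : ℝ} (hθ : 0 < θ) (v : PS d) (h : MemPS θ ρ r v) (j k) :
    ofPS hθ v h j k = ((θ ^ (∑ i, j i) : ℝ) : ℂ) * (((Real.sqrt (wt ρ r k) : ℝ) : ℂ) * v j k) :=
  rfl

lemma norm_ofPS {d : ℕ} {θ ρ r : ℝ} (hθ : 0 < θ) (v : PS d) (h : MemPS θ ρ r v) :
    ‖ofPS hθ v h‖ = psNorm θ ρ r v := by
  rw [lp.norm_eq_tsum_rpow (by norm_num)]
  simp only [ENNReal.toReal_one, Real.rpow_one, div_one, psNorm]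
  refine tsum_congr fun j => ?_
  change ‖((θ ^ (∑ i, j i) : ℝ) : ℂ) • toL (v j) (h.1 j)‖ = _
  rw [norm_smul, norm_toL, Complex.norm_real, Real.norm_of_nonneg (by positivity), mul_comm]
  rfl

/-- the power series attached to an element of the model -/
def toPS {d : ℕ} (θ ρ r : ℝ) (x : EL d) : PS d := fun j k =>
  ((θ ^ (∑ i, j i) : ℝ) : ℂ)⁻¹ * (((Real.sqrt (wt ρ r k) : ℝ) : ℂ)⁻¹ * x j k)

lemma sqrt_wt_ne {d : ℕ} (ρ r : ℝ) (k : Fin d → ℤ) : ((Real.sqrt (wt ρ r k) : ℝ) : ℂ) ≠ 0 := by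
  have := Real.sqrt_pos.2 (wt_pos ρ r k)
  exact_mod_cast this.ne'

lemma pow_ne {θ : ℝ} (hθ : 0 < θ) (n : ℕ) : ((θ ^ n : ℝ) : ℂ) ≠ 0 := by
  have : 0 < θ ^ n := by positivity
  exact_mod_cast this.ne'

lemma toPS_ofPS {d : ℕ} {θ ρ r : ℝ} (hθ : 0 < θ) (v : PS d) (h : MemPS θ ρ r v) :
    toPS θ ρ r (ofPS hθ v h) = v := by
  funext j k
  rw [toPS, ofPS_apply]
  have h1 := sqrt_wt_ne ρ r k
  have h2 := pow_ne hθ (∑ i, j i)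
  field_simp

lemma toPS_injective {d : ℕ} {θ ρ r : ℝ} (hθ : 0 < θ) :
    Function.Injective (toPS (d := d) θ ρ r) := by
  intro x y hxy
  ext j k
  have h := congrFun (congrFun hxy j) k
  have h1 := sqrt_wt_ne ρ r k
  have h2 := pow_ne hθ (∑ i, j i)
  exact mul_left_cancel₀ (inv_ne_zero h1) (mul_left_cancel₀ (inv_ne_zero h2) h)

lemma memH_of_lp {d : ℕ} {ρ r : ℝ} (a : ℂ) (y : HL d) :
    MemH ρ r (fun k => a * (((Real.sqrt (wt ρ r k) : ℝ) : ℂ)⁻¹ * y k)) := by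
  rw [memH_iff]
  have e : (fun k => ((Real.sqrt (wt ρ r k) : ℝ) : ℂ) *
      (a * (((Real.sqrt (wt ρ r k) : ℝ) : ℂ)⁻¹ * y k))) = ⇑(a • y) := by
    funext k
    have h1 := sqrt_wt_ne ρ r k
    simp only [lp.coeFn_smul, Pi.smul_apply, smul_eq_mul]
    field_simp
  rw [e]
  exact lp.memℓp _

lemma memPS_toPS {d : ℕ} {θ ρ r : ℝ} (hθ : 0 < θ) (x : EL d) : MemPS θ ρ r (toPS θ ρ r x) := by
  have hm : ∀ j, MemH ρ r (toPS θ ρ r x j) := fun j => memH_of_lp _ (x j)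
  refine ⟨hm, ?_⟩
  have hx := (lp.memℓp x).summable (by norm_num)
  refine hx.congr fun j => ?_
  simp only [ENNReal.toReal_one, Real.rpow_one]
  rw [psSummand, ← norm_toL _ (hm j)]
  have e : x j = ((θ ^ (∑ i, j i) : ℝ) : ℂ) • toL _ (hm j) := by
    ext k
    have h1 := sqrt_wt_ne ρ r k
    have h2 := pow_ne hθ (∑ i, j i)
    simp only [lp.coeFn_smul, Pi.smul_apply, smul_eq_mul, toL_apply, toPS]
    field_simp
  conv_lhs => rw [e]
  rw [norm_smul, Complex.norm_real, Real.norm_of_nonneg (by positivity), mul_comm]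

lemma ofPS_toPS {d : ℕ} {θ ρ r : ℝ} (hθ : 0 < θ) (x : EL d) :
    ofPS hθ (toPS θ ρ r x) (memPS_toPS hθ x) = x :=
  toPS_injective (ρ := ρ) (r := r) hθ (toPS_ofPS hθ _ _)

lemma psNorm_toPS {d : ℕ} {θ ρ r : ℝ} (hθ : 0 < θ) (x : EL d) :
    psNorm θ ρ r (toPS θ ρ r x) = ‖x‖ := by
  rw [← norm_ofPS hθ _ (memPS_toPS hθ x), ofPS_toPS]

lemma toPS_add {d : ℕ} {θ ρ r : ℝ} (x y : EL d) :
    toPS θ ρ r (x + y) = fun j => toPS θ ρ r x j + toPS θ ρ r y j := by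
  funext j k
  simp only [toPS, lp.coeFn_add, Pi.add_apply]
  ring

lemma toPS_smul {d : ℕ} {θ ρ r : ℝ} (a : ℂ) (x : EL d) :
    toPS θ ρ r (a • x) = fun j k => a * toPS θ ρ r x j k := by
  funext j k
  simp only [toPS, lp.coeFn_smul, Pi.smul_apply, smul_eq_mul]
  ring

/-- existence of the abstract product -/
lemma exists_mul {d : ℕ} {θ ρ r : ℝ} (hθ : 0 < θ) (hρ : 0 ≤ ρ) (hr : (d : ℝ) / 2 < r) :
    ∃ B : EL d → EL d → EL d,
      (∀ x y, toPS θ ρ r (B x y) = psMul (toPS θ ρ r x) (toPS θ ρ r y)) ∧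
      (∀ x y, ‖B x y‖ ≤ Real.sqrt (Mc d r) * (‖x‖ * ‖y‖)) ∧
      (∀ x x' y, B (x + x') y = B x y + B x' y) ∧
      (∀ x y y', B x (y + y') = B x y + B x y') := by
  have hm := fun x y : EL d => memPS_mul hθ.le hρ hr
    (memPS_toPS (ρ := ρ) (r := r) hθ x) (memPS_toPS (ρ := ρ) (r := r) hθ y)
  refine ⟨fun x y => ofPS hθ _ (hm x y).1, fun x y => toPS_ofPS _ _ _, fun x y => ?_,
    fun x x' y => ?_, fun x y y' => ?_⟩
  · rw [norm_ofPS]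
    simpa only [psNorm_toPS hθ] using (hm x y).2
  · apply toPS_injective (ρ := ρ) (r := r) hθ
    simp only [toPS_add, toPS_ofPS]
    exact psMul_add_left hρ hr (memPS_toPS hθ _) (memPS_toPS hθ _) (memPS_toPS hθ _)
  · apply toPS_injective (ρ := ρ) (r := r) hθ
    simp only [toPS_add, toPS_ofPS]
    exact psMul_add_right hρ hr (memPS_toPS hθ _) (memPS_toPS hθ _) (memPS_toPS hθ _)

/-- diagonal multiplier on power series -/
def psDiag {d : ℕ} (l : (Fin d → ℤ) → ℂ) (v : PS d) : PS d := fun j k => l k * v j k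

lemma exists_diag {d : ℕ} {θ : ℝ} (ρ r : ℝ) (hθ : 0 < θ) {C : ℝ} (hC : 0 ≤ C)
    (l : (Fin d → ℤ) → ℂ) (hl : ∀ k, ‖l k‖ ≤ C) :
    ∃ D : EL d → EL d,
      (∀ x, toPS θ ρ r (D x) = psDiag l (toPS θ ρ r x)) ∧
      (∀ x, ‖D x‖ ≤ C * ‖x‖) ∧ (∀ x y, D (x + y) = D x + D y) := by
  have hm : ∀ x : EL d, MemPS θ ρ r (psDiag l (toPS θ ρ r x)) ∧
      psNorm θ ρ r (psDiag l (toPS θ ρ r x)) ≤ C * psNorm θ ρ r (toPS θ ρ r x) :=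
    fun x => memPS_diag hθ.le (memPS_toPS (ρ := ρ) (r := r) hθ x) hC l hl
  refine ⟨fun x => ofPS hθ _ (hm x).1, fun x => toPS_ofPS _ _ _, fun x => ?_, fun x y => ?_⟩
  · rw [norm_ofPS]
    simpa only [psNorm_toPS hθ] using (hm x).2
  · apply toPS_injective (ρ := ρ) (r := r) hθ
    simp only [toPS_add, toPS_ofPS]
    funext j k
    simp only [psDiag, Pi.add_apply, mul_add]

lemma fixed_pt {E : Type*} [NormedAddCommGroup E] [CompleteSpace E] {s : ℝ} (hs : 0 ≤ s)
    (F : E → E) (hF : ∀ x, ‖x‖ ≤ s → ‖F x‖ ≤ s)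
    (hF2 : ∀ x y, ‖x‖ ≤ s → ‖y‖ ≤ s → ‖F x - F y‖ ≤ 1 / 2 * ‖x - y‖) :
    ∃! x, ‖x‖ ≤ s ∧ F x = x := by
  have hmap : Set.MapsTo F (Metric.closedBall 0 s) (Metric.closedBall 0 s) := by
    intro x hx
    rw [mem_closedBall_zero_iff] at *
    exact hF x hx
  have hc : ContractingWith (1 / 2) (hmap.restrict F _ _) := by
    refine ⟨by rw [div_lt_one (by norm_num)]; norm_num, LipschitzWith.of_dist_le_mul ?_⟩
    rintro ⟨x, hx⟩ ⟨y, hy⟩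
    rw [mem_closedBall_zero_iff] at hx hy
    simp only [Subtype.dist_eq, Set.MapsTo.val_restrict_apply, dist_eq_norm]
    simpa using hF2 x y hx hy
  obtain ⟨x, hx, hfx, _⟩ := hc.exists_fixedPoint' Metric.isClosed_closedBall.isComplete hmap
    (x := 0) (by simpa using hs) (edist_ne_top _ _)
  rw [mem_closedBall_zero_iff] at hx
  refine ⟨x, ⟨hx, hfx⟩, ?_⟩
  rintro y ⟨hy, hfy⟩
  have h := hF2 y x hy hx
  rw [hfy, hfx.eq] at h
  have h0 := norm_nonneg (y - x)
  have : ‖y - x‖ = 0 := by linarith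
  exact sub_eq_zero.1 (norm_eq_zero.1 this)

lemma contraction_core {E : Type*} [NormedAddCommGroup E] [NormedSpace ℂ E] [CompleteSpace E]
    {C K s : ℝ} (hC : 0 ≤ C) (hK : 0 ≤ K) (hs : 0 ≤ s) (hCK : C * K * s ≤ 1 / 16)
    (B : E → E → E) (hB : ∀ x y, ‖B x y‖ ≤ K * (‖x‖ * ‖y‖))
    (hBl : ∀ x x' y, B (x + x') y = B x y + B x' y)
    (hBr : ∀ x y y', B x (y + y') = B x y + B x y')
    (D : E → E) (hD : ∀ x, ‖D x‖ ≤ C * ‖x‖) (hDa : ∀ x y, D (x + y) = D x + D y)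
    (b : E) (hb : ‖b‖ ≤ s) (μ : ℂ) (hμ : C * ‖μ‖ ≤ 1 / 4) :
    ∃! x, ‖x‖ ≤ s ∧ D (-μ • x + B (x + b) (x + b)) = x := by
  refine fixed_pt hs (fun x => D (-μ • x + B (x + b) (x + b))) ?_ ?_
  · intro x hx
    have h1 : ‖x + b‖ ≤ 2 * s := (norm_add_le _ _).trans (by linarith)
    have h2 : ‖-μ • x + B (x + b) (x + b)‖ ≤ ‖μ‖ * s + K * (2 * s * (2 * s)) := by
      refine (norm_add_le _ _).trans (add_le_add ?_ ((hB _ _).trans ?_))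
      · rw [norm_smul, norm_neg]; gcongr
      · gcongr
    calc _ ≤ C * (‖μ‖ * s + K * (2 * s * (2 * s))) := (hD _).trans (by gcongr)
      _ = (C * ‖μ‖) * s + 4 * (C * K * s) * s := by ring
      _ ≤ 1 / 4 * s + 4 * (1 / 16) * s := by gcongr
      _ ≤ s := by linarith
  · intro x y hx hy
    have h1 : ‖x + b‖ ≤ 2 * s := (norm_add_le _ _).trans (by linarith)
    have h1' : ‖y + b‖ ≤ 2 * s := (norm_add_le _ _).trans (by linarith)
    have e1 : B (x + b) (x + b) = B (x - y) (x + b) + (B (y + b) (x - y) + B (y + b) (y + b)) := by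
      rw [← hBr, show x - y + (y + b) = x + b by abel, ← hBl,
        show x - y + (y + b) = x + b by abel]
    have e : -μ • x + B (x + b) (x + b) =
        (-μ • (x - y) + (B (x - y) (x + b) + B (y + b) (x - y))) +
          (-μ • y + B (y + b) (y + b)) := by
      rw [e1, smul_sub]; abel
    rw [e, hDa, add_sub_cancel_right]
    have h2 : ‖-μ • (x - y) + (B (x - y) (x + b) + B (y + b) (x - y))‖ ≤
        ‖μ‖ * ‖x - y‖ + (K * (‖x - y‖ * (2 * s)) + K * (2 * s * ‖x - y‖)) := by
      refine (norm_add_le _ _).trans (add_le_add ?_ ((norm_add_le _ _).trans (add_le_add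
        ((hB _ _).trans ?_) ((hB _ _).trans ?_))))
      · rw [norm_smul, norm_neg]
      · gcongr
      · gcongr
    calc _ ≤ C * (‖μ‖ * ‖x - y‖ + (K * (‖x - y‖ * (2 * s)) + K * (2 * s * ‖x - y‖))) :=
          (hD _).trans (by gcongr)
      _ = (C * ‖μ‖) * ‖x - y‖ + 4 * (C * K * s) * ‖x - y‖ := by ring
      _ ≤ 1 / 4 * ‖x - y‖ + 4 * (1 / 16) * ‖x - y‖ := by gcongr
      _ = _ := by ring

lemma exists_inv_bound {d : ℕ} (ν : Fin d → ℝ) (hν : ∀ i, ν i ∈ Set.Icc (1 : ℝ) 2) (m₀ : ℝ) :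
    ∃ C : ℝ, 0 < C ∧ ∀ k : Fin d → ℤ,
      ‖(if Upsilon ν m₀ k = 0 then (0 : ℂ) else ((Upsilon ν m₀ k : ℝ) : ℂ)⁻¹)‖ ≤ C := by
  have hfin : {k : Fin d → ℤ | |Upsilon ν m₀ k| < 1}.Finite := by
    obtain ⟨N, hN⟩ := exists_nat_gt (m₀ + 1)
    refine (Finset.finite_toSet
      (Fintype.piFinset fun _ : Fin d => Finset.Icc (-(N : ℤ)) N)).subset ?_
    intro k hk
    simp only [Finset.mem_coe, Fintype.mem_piFinset, Finset.mem_Icc]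
    intro i
    have h1 : ((k i : ℝ)) ^ 2 ≤ ∑ i, (ν i) ^ 2 * (k i : ℝ) ^ 2 := by
      have h2 := Finset.single_le_sum (f := fun i => (ν i) ^ 2 * (k i : ℝ) ^ 2)
        (fun _ _ => by positivity) (Finset.mem_univ i)
      have h3 : (1 : ℝ) ≤ ν i ^ 2 := one_le_pow₀ (hν i).1
      nlinarith [sq_nonneg (k i : ℝ)]
    have h4 : ((k i : ℝ)) ^ 2 < N := by
      have hk' : |Upsilon ν m₀ k| < 1 := hk
      have := (abs_lt.1 hk').1
      unfold Upsilon at this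
      linarith
    have h5 : (k i) ^ 2 < (N : ℤ) := by exact_mod_cast h4
    constructor <;> nlinarith
  obtain ⟨C, hC⟩ := (hfin.image fun k => ‖((Upsilon ν m₀ k : ℝ) : ℂ)⁻¹‖).bddAbove
  refine ⟨max C 1, by positivity, fun k => ?_⟩
  split_ifs with h
  · rw [norm_zero]; positivity
  · by_cases hk : |Upsilon ν m₀ k| < 1
    · exact (hC ⟨k, hk, rfl⟩).trans (le_max_left _ _)
    · refine le_trans ?_ (le_max_right _ _)
      rw [norm_inv, Complex.norm_real, Real.norm_eq_abs]
      exact inv_le_one_of_one_le₀ (not_lt.1 hk)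

lemma ps_ext_iff {d : ℕ} (u v : PS d) : u = v ↔ ∀ j k, u j k = v j k :=
  ⟨fun h _ _ => h ▸ rfl, fun h => funext fun j => funext fun k => h j k⟩

end Aux

open Aux in
/-- (Solution of the range equation.) Suppose the kernel of `L_{ν,𝔪₀}`
is spanned by the exponentials `e^{i k^m·x}`, `m = 1,…,2^d` (i.e. `Υ_k = 0` exactly for
`k` in the range of `km`). Then for `θ > 0` small there exist `ε₀ > 0` and `s > 0` such
that whenever `|𝔪 − 𝔪₀| ≤ ε₀`, the range equation
`v̂ = (L^R_{ν,𝔪₀})^{-1}(−(𝔪−𝔪₀)v̂ + Π_R (v̂ + v̄)²)` has a unique solution `v̂` in the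
closed ball of radius `s` of the Banach algebra `H^{θ,ρ,r}`; in particular `v̂` is given by
a convergent power series in `α ∈ ℂ^{2^d}`, hence analytic in `α`. -/
theorem stmt13 (d : ℕ) (hd : 0 < d) (ρ : ℝ) (hρ : 0 ≤ ρ) (r : ℕ) (hr : (d : ℝ) / 2 < r)
    (ν : Fin d → ℝ) (hν : ∀ i, ν i ∈ Set.Icc (1 : ℝ) 2) (m₀ : ℝ) (hm₀ : 0 < m₀)
    (km : Fin (2 ^ d) → Fin d → ℤ) (hinj : Function.Injective km)
    (hker : {k : Fin d → ℤ | Upsilon ν m₀ k = 0} = Set.range km) :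
    ∃ θ₀ : ℝ, 0 < θ₀ ∧ ∀ θ : ℝ, 0 < θ → θ < θ₀ →
      ∃ ε₀ : ℝ, 0 < ε₀ ∧ ∃ s : ℝ, 0 < s ∧
        ∀ μ : ℝ, |μ| ≤ ε₀ →
          ∃! vh : PS d,
            (MemPS θ ρ r vh ∧ psNorm θ ρ r vh ≤ s) ∧
            ∀ (j : Fin (2 ^ d) → ℕ) (k : Fin d → ℤ),
              vh j k =
                if Upsilon ν m₀ k = 0 then 0
                else ((-(μ : ℂ)) * vh j k +
                    psMul (fun j' => vh j' + vbar km j')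
                      (fun j' => vh j' + vbar km j') j k) /
                  ((Upsilon ν m₀ k : ℝ) : ℂ) := by
  have hr' : (d : ℝ) / 2 < ((r : ℕ) : ℝ) := hr
  obtain ⟨C, hC, hl⟩ := exists_inv_bound ν hν m₀
  obtain ⟨V, hV, hvb⟩ := vbar_spec ρ (r : ℝ) km
  set K := Real.sqrt (Mc d (r : ℝ)) with hK
  have hK0 : 0 ≤ K := Real.sqrt_nonneg _
  set s : ℝ := 1 / (16 * (C * K + 1)) with hs
  have hCK : 0 ≤ C * K := by positivity
  have hs0 : 0 < s := by positivity
  have hCKs : C * K * s ≤ 1 / 16 := by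
    rw [hs, mul_one_div, div_le_div_iff₀ (by positivity) (by norm_num)]
    linarith
  refine ⟨s / (V + 1), by positivity, fun θ hθ hθ0 => ⟨1 / (4 * C), by positivity, s, hs0,
    fun μ hμ => ?_⟩⟩
  obtain ⟨hbm, hbn⟩ := hvb θ
  obtain ⟨B, hB1, hB2, hB3, hB4⟩ := exists_mul (d := d) (r := (r : ℝ)) hθ hρ hr'
  obtain ⟨D, hD1, hD2, hD3⟩ := exists_diag ρ (r : ℝ) hθ hC.le _ hl
  have hb : ‖ofPS hθ _ hbm‖ ≤ s := by
    rw [norm_ofPS, hbn]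
    rw [lt_div_iff₀ (by positivity)] at hθ0
    nlinarith
  have hμ' : C * ‖(μ : ℂ)‖ ≤ 1 / 4 := by
    rw [Complex.norm_real, Real.norm_eq_abs]
    calc C * |μ| ≤ C * (1 / (4 * C)) := by gcongr
      _ = 1 / 4 := by field_simp
  obtain ⟨x, ⟨hx1, hx2⟩, hx3⟩ := contraction_core hC.le hK0 hs0.le hCKs B hB2 hB3 hB4 D hD2 hD3
    (ofPS hθ _ hbm) hb (μ : ℂ) hμ'
  have key : ∀ y : EL d,
      D (-(μ : ℂ) • y + B (y + ofPS hθ _ hbm) (y + ofPS hθ _ hbm)) = y ↔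
      ∀ (j : Fin (2 ^ d) → ℕ) (k : Fin d → ℤ),
        toPS θ ρ r y j k = if Upsilon ν m₀ k = 0 then 0
          else ((-(μ : ℂ)) * toPS θ ρ r y j k +
              psMul (fun j' => toPS θ ρ r y j' + vbar km j')
                (fun j' => toPS θ ρ r y j' + vbar km j') j k) /
            ((Upsilon ν m₀ k : ℝ) : ℂ) := by
    intro y
    rw [← (toPS_injective (ρ := ρ) (r := (r : ℝ)) hθ).eq_iff, hD1]
    simp only [toPS_add, hB1, toPS_smul, toPS_ofPS, ps_ext_iff, psDiag]
    refine forall_congr' fun j => forall_congr' fun k => ?_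
    rw [eq_comm]
    refine Eq.congr rfl ?_
    split_ifs
    · simp
    · rw [div_eq_inv_mul]; rfl
  refine ⟨toPS θ ρ r x, ⟨⟨memPS_toPS hθ x, by rw [psNorm_toPS hθ]; exact hx1⟩, (key x).1 hx2⟩, ?_⟩
  rintro v ⟨⟨hv1, hv2⟩, hv3⟩
  have hvx := toPS_ofPS hθ v hv1
  have := hx3 (ofPS hθ v hv1) ⟨by rw [norm_ofPS]; exact hv2, by
    refine (key _).2 ?_
    rw [hvx]; exact hv3⟩
  rw [← this, hvx]
end
end

section
/- Fix 𝔪 > 0 and let δ > 0 be sufficiently small. The set Ĩ = {(ω, ν) ∈ [1,2]^{1+d} : ∃ l ∈ ℤ, k ∈ ℤ^d such that |−ω²l² − Σ_{i=1}^d k_i²ν_i² + 𝔪| ≤ δ} has Lebesgue measure O(δ): there is a constant C (depending on 𝔪 and d but not on δ) with mes(Ĩ) ≤ Cδ. -/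
open scoped BigOperators

noncomputable section

def boxT {n : ℕ} (m δ : ℝ) (q : Fin (n + 1) → ℤ) : Set (Fin (n + 1) → ℝ) :=
  {x | (∀ i, x i ∈ Set.Icc (1 : ℝ) 2) ∧ |m - ∑ i, (q i : ℝ) ^ 2 * (x i) ^ 2| ≤ δ}

lemma boxT_closed {n : ℕ} (m δ : ℝ) (q : Fin (n + 1) → ℤ) : IsClosed (boxT m δ q) := by
  have h : boxT m δ q = (⋂ i, {x | x i ∈ Set.Icc (1 : ℝ) 2}) ∩
      {x | |m - ∑ i, (q i : ℝ) ^ 2 * (x i) ^ 2| ≤ δ} := by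
    ext x; simp [boxT]
  rw [h]
  refine IsClosed.inter (isClosed_iInter fun i => ?_) ?_
  · exact isClosed_Icc.preimage (continuous_apply i)
  · exact isClosed_le (by fun_prop) continuous_const

lemma boxT_vol {n : ℕ} (m δ : ℝ) (hδ : 0 < δ) (q : Fin (n + 1) → ℤ) (j : Fin (n + 1))
    (hj : q j ≠ 0) : MeasureTheory.volume (boxT m δ q) ≤ ENNReal.ofReal δ := by
  have hmp := (MeasureTheory.volume_preserving_piFinSuccAbove (fun _ : Fin (n + 1) => ℝ) j).symm
  have hms : MeasurableSet (boxT m δ q) := (boxT_closed m δ q).measurableSet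
  rw [← hmp.measure_preimage hms.nullMeasurableSet]
  rw [MeasureTheory.Measure.volume_eq_prod,
    MeasureTheory.Measure.prod_apply_symm (hmp.measurable hms)]
  have hB : MeasurableSet (Set.Icc (fun _ => 1 : Fin n → ℝ) (fun _ => 2)) := measurableSet_Icc
  calc _ ≤ ∫⁻ y, (Set.Icc (fun _ => 1 : Fin n → ℝ) (fun _ => 2)).indicator
        (fun _ => ENNReal.ofReal δ) y := ?_
    _ = ENNReal.ofReal δ := by
        rw [MeasureTheory.lintegral_indicator hB, MeasureTheory.lintegral_const,
          MeasureTheory.Measure.restrict_apply_univ, Real.volume_Icc_pi]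
        norm_num
  refine MeasureTheory.lintegral_mono fun y => ?_
  by_cases hy : y ∈ Set.Icc (fun _ => 1 : Fin n → ℝ) (fun _ => 2)
  · rw [Set.indicator_of_mem hy]
    refine (Real.volume_le_diam _).trans ?_
    refine Metric.ediam_le fun a ha b hb => ?_
    rw [edist_dist]
    apply ENNReal.ofReal_le_ofReal
    simp only [Set.mem_preimage, boxT, Set.mem_ofPred_eq, MeasurableEquiv.piFinSuccAbove_symm_apply,
      Fin.insertNthEquiv_apply, Fin.sum_univ_succAbove _ j, Fin.insertNth_apply_same,
      Fin.insertNth_apply_succAbove] at ha hb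
    have ha1 := ha.1 j
    have hb1 := hb.1 j
    simp only [Fin.insertNth_apply_same, Set.mem_Icc] at ha1 hb1
    have ha2 := abs_le.1 ha.2
    have hb2 := abs_le.1 hb.2
    have hq : (1 : ℝ) ≤ (q j : ℝ) ^ 2 := by
      have : 1 ≤ (q j) ^ 2 := by have := sq_pos_of_ne_zero hj; omega
      exact_mod_cast this
    rw [Real.dist_eq]
    have h1 : (q j : ℝ) ^ 2 * |a ^ 2 - b ^ 2| ≤ 2 * δ := by
      rw [← abs_of_nonneg (sq_nonneg (q j : ℝ)), ← abs_mul, abs_le]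
      constructor <;> linarith
    have h2 : |a ^ 2 - b ^ 2| = |a - b| * (a + b) := by
      rw [← abs_of_nonneg (by linarith : 0 ≤ a + b), ← abs_mul]
      ring_nf
    have h3 := abs_nonneg (a - b)
    have h4 : |a - b| * 2 ≤ |a ^ 2 - b ^ 2| := by
      rw [h2]; exact mul_le_mul_of_nonneg_left (by linarith) h3
    nlinarith
  · rw [Set.indicator_of_notMem hy]
    have : ((fun x => (x, y)) ⁻¹' ((MeasurableEquiv.piFinSuccAbove
        (fun _ : Fin (n + 1) => ℝ) j).symm ⁻¹' boxT m δ q)) = ∅ := by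
      ext x
      simp only [Set.mem_preimage, Set.mem_empty_iff_false, iff_false]
      intro h
      apply hy
      have h1 : ∀ i, y i ∈ Set.Icc (1 : ℝ) 2 := fun i => by
        have := h.1 (j.succAbove i)
        simpa using this
      exact ⟨fun i => (h1 i).1, fun i => (h1 i).2⟩
    rw [this]; simp

/-- (Measure of the resonant set for the evolution problem, `b = 1`.)
Fix `𝔪 > 0`. For `δ > 0` let
`Ĩ = {(ω,ν) ∈ [1,2]^{1+d} : ∃ l ∈ ℤ, k ∈ ℤ^d, |−ω²l² − ∑ᵢ kᵢ²νᵢ² + 𝔪| ≤ δ}`. Then there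
are `C > 0` and `δ₀ > 0` (independent of `δ`) with `mes(Ĩ) ≤ C·δ` for all `0 < δ < δ₀`. -/
theorem stmt15 (d : ℕ) (hd : 0 < d) (m : ℝ) (hm : 0 < m) :
    ∃ C : ℝ, 0 < C ∧ ∃ δ₀ : ℝ, 0 < δ₀ ∧ ∀ δ : ℝ, 0 < δ → δ < δ₀ →
      MeasureTheory.volume
        {p : ℝ × (Fin d → ℝ) |
          (p.1 ∈ Set.Icc (1 : ℝ) 2 ∧ ∀ i, p.2 i ∈ Set.Icc (1 : ℝ) 2) ∧
          ∃ (l : ℤ) (k : Fin d → ℤ),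
            |(-(p.1 ^ 2 * (l : ℝ) ^ 2) - ∑ i, (k i : ℝ) ^ 2 * (p.2 i) ^ 2) + m| ≤ δ} ≤
        ENNReal.ofReal (C * δ) := by
  obtain ⟨N, hN⟩ := exists_nat_ge (2 * m)
  let F : Finset (Fin (d + 1) → ℤ) :=
    (Fintype.piFinset fun _ => Finset.Icc (-(N : ℤ)) N).filter (fun q => q ≠ 0)
  refine ⟨(F.card : ℝ) + 1, by positivity, m / 2, by positivity, fun δ hδ hδm => ?_⟩
  have hmp := (MeasureTheory.volume_preserving_piFinSuccAbove
    (fun _ : Fin (d + 1) => ℝ) 0).symm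
  have hU : MeasurableSet (⋃ q ∈ F, boxT m δ q) :=
    F.measurableSet_biUnion fun q _ => (boxT_closed m δ q).measurableSet
  have hvol : MeasureTheory.volume (⋃ q ∈ F, boxT m δ q) ≤
      ENNReal.ofReal (((F.card : ℝ) + 1) * δ) := by
    refine (MeasureTheory.measure_biUnion_finset_le _ _).trans ?_
    calc _ ≤ ∑ q ∈ F, ENNReal.ofReal δ := by
          refine Finset.sum_le_sum fun q hq => ?_
          have hq0 : q ≠ 0 := (Finset.mem_filter.1 hq).2
          obtain ⟨j, hj⟩ := Function.ne_iff.1 hq0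
          exact boxT_vol m δ hδ q j hj
      _ = ENNReal.ofReal (F.card * δ) := by
          rw [Finset.sum_const, ENNReal.ofReal_mul (by positivity), nsmul_eq_mul,
            ENNReal.ofReal_natCast]
      _ ≤ _ := ENNReal.ofReal_le_ofReal (by nlinarith)
  refine le_trans ?_ hvol
  rw [← hmp.measure_preimage hU.nullMeasurableSet]
  refine MeasureTheory.measure_mono ?_
  rintro ⟨w, v⟩ ⟨⟨hw, hv⟩, l, k, h⟩
  simp only at hw hv h
  have he : (MeasurableEquiv.piFinSuccAbove (fun _ : Fin (d + 1) => ℝ) 0).symm (w, v) =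
      (Fin.cons w v : Fin (d + 1) → ℝ) := by
    rw [MeasurableEquiv.piFinSuccAbove_symm_apply]
    ext i
    refine Fin.cases ?_ (fun i => ?_) i <;> simp
  rw [Set.mem_preimage, he]
  simp only [Set.mem_iUnion]
  have key : |m - ∑ i, ((Fin.cons l k : Fin (d + 1) → ℤ) i : ℝ) ^ 2 *
      ((Fin.cons w v : Fin (d + 1) → ℝ) i) ^ 2| ≤ δ := by
    rw [Fin.sum_univ_succ]
    simp only [Fin.cons_zero, Fin.cons_succ]
    convert h using 2
    ring
  have hbox : ∀ i, (Fin.cons w v : Fin (d + 1) → ℝ) i ∈ Set.Icc (1 : ℝ) 2 := by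
    intro i
    refine Fin.cases ?_ (fun i => ?_) i
    · simpa using hw
    · simpa using hv i
  refine ⟨Fin.cons l k, ?_, hbox, key⟩
  generalize (Fin.cons l k : Fin (d + 1) → ℤ) = q at key
  generalize (Fin.cons w v : Fin (d + 1) → ℝ) = x at key hbox
  have hk := abs_le.1 key
  refine Finset.mem_filter.2 ⟨Fintype.mem_piFinset.2 fun i => ?_, ?_⟩
  · have h1 : (q i : ℝ) ^ 2 * (x i) ^ 2 ≤ ∑ i, (q i : ℝ) ^ 2 * (x i) ^ 2 :=
      Finset.single_le_sum (f := fun i => (q i : ℝ) ^ 2 * (x i) ^ 2)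
        (fun i _ => by positivity) (Finset.mem_univ i)
    have h2 : (1 : ℝ) ≤ (x i) ^ 2 := by have := (hbox i).1; nlinarith
    have h3 : (q i : ℝ) ^ 2 ≤ N := by nlinarith [sq_nonneg (q i : ℝ)]
    have h4 : (q i) ^ 2 ≤ (N : ℤ) := by exact_mod_cast h3
    rw [Finset.mem_Icc]
    have h5 := Int.le_self_sq (q i)
    have h6 := Int.le_self_sq (-(q i))
    rw [neg_sq] at h6
    constructor <;> linarith
  · rintro rfl
    simp at hk
    linarith
end
end
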